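/- Let H be a symmetric positive definite p×p real matrix, A an s×p real matrix with full row rank, e ∈ ℝ^p, and suppose there exists μ* ∈ ℝ^s with e = -Aᵀ μ* (first-order stationarity of the underlying nonlinear program at the point being perturbed). Let H̃ be a symmetric p×p matrix, ẽ ∈ ℝ^p, b̃ ∈ ℝ^s. For ε small let d*_ε be the unique minimizer of L_ε(d) = (1/2) dᵀ (H + ε H̃) d + (e + ε ẽ)ᵀ d subject to A d = ε b̃. Define M = (A H⁻¹ Aᵀ)⁻¹ and B w = H⁻¹(Aᵀ M A H⁻¹ − I) ẽ + H⁻¹ Aᵀ M b̃. Then d*_ε = ε B w + o(ε) as ε → 0. -/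

import Mathlib

open Matrix Asymptotics Filter Topology

/-- A positive definite quadratic form on `ℝⁿ` is coercive for the supremum norm. -/
theorem Matrix.PosDef.exists_mul_sq_norm_le {n : Type*} [Fintype n] {H : Matrix n n ℝ}
    (hH : H.PosDef) : ∃ c : ℝ, 0 < c ∧ ∀ x : n → ℝ, c * ‖x‖ ^ 2 ≤ x ⬝ᵥ H *ᵥ x := by
  rcases (Metric.sphere (0 : n → ℝ) 1).eq_empty_or_nonempty with h | h
  · refine ⟨1, one_pos, fun x => ?_⟩
    have hx : x = 0 := by
      by_contra hx
      have : ‖x‖⁻¹ • x ∈ Metric.sphere (0 : n → ℝ) 1 := by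
        simp [norm_smul, norm_ne_zero_iff.mpr hx]
      simp [h] at this
    simp [hx]
  · obtain ⟨y, hy, hmin⟩ := (isCompact_sphere (0 : n → ℝ) 1).exists_isMinOn h
      (f := fun x => x ⬝ᵥ H *ᵥ x) (by fun_prop)
    have hy0 : y ≠ 0 := by
      rintro rfl
      simp at hy
    refine ⟨y ⬝ᵥ H *ᵥ y, by simpa using hH.dotProduct_mulVec_pos hy0, fun x => ?_⟩
    by_cases hx : x = 0
    · simp [hx]
    have hn : ‖x‖ ≠ 0 := norm_ne_zero_iff.mpr hx
    have h1 : y ⬝ᵥ H *ᵥ y ≤ (‖x‖⁻¹ • x) ⬝ᵥ H *ᵥ (‖x‖⁻¹ • x) :=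
      hmin (by simp [norm_smul, hn])
    calc (y ⬝ᵥ H *ᵥ y) * ‖x‖ ^ 2
        ≤ ((‖x‖⁻¹ • x) ⬝ᵥ H *ᵥ (‖x‖⁻¹ • x)) * ‖x‖ ^ 2 := by gcongr
      _ = x ⬝ᵥ H *ᵥ x := by
        simp only [mulVec_smul, dotProduct_smul, smul_dotProduct, smul_eq_mul]
        field_simp

/-- A matrix bilinear form is bounded for the supremum norm. -/
theorem Matrix.exists_abs_dotProduct_mulVec_le {m n : Type*} [Fintype m] [Fintype n]
    (B : Matrix m n ℝ) :
    ∃ C : ℝ, 0 ≤ C ∧ ∀ (x : m → ℝ) (y : n → ℝ), |x ⬝ᵥ B *ᵥ y| ≤ C * ‖x‖ * ‖y‖ := by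
  refine ⟨∑ i, ∑ j, |B i j|, by positivity, fun x y => ?_⟩
  simp only [dotProduct, mulVec, Finset.mul_sum, Finset.sum_mul]
  refine (Finset.abs_sum_le_sum_abs _ _).trans (Finset.sum_le_sum fun i _ => ?_)
  refine (Finset.abs_sum_le_sum_abs _ _).trans (Finset.sum_le_sum fun j _ => ?_)
  rw [abs_mul, abs_mul]
  calc |x i| * (|B i j| * |y j|) = |B i j| * |x i| * |y j| := by ring
    _ ≤ |B i j| * ‖x‖ * ‖y‖ := by
      gcongr
      · exact norm_le_pi_norm x i
      · exact norm_le_pi_norm y j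

/-- If a quadratic polynomial in one real variable without constant term is nonnegative, then its
linear coefficient vanishes. -/
theorem eq_zero_of_forall_mul_add_sq_mul_nonneg {a b : ℝ}
    (h : ∀ t : ℝ, 0 ≤ t * a + t ^ 2 * b) : a = 0 := by
  have hb : 0 < |b| + 1 := by positivity
  have h1 := h (-a / (|b| + 1))
  have h2 : -a / (|b| + 1) * a + (-a / (|b| + 1)) ^ 2 * b
      = a ^ 2 * (b - |b| - 1) / (|b| + 1) ^ 2 := by
    field_simp
    ring
  rw [h2, le_div_iff₀ (by positivity), zero_mul] at h1
  have := le_abs_self b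
  have : a ^ 2 = 0 := by nlinarith [sq_nonneg a]
  simpa using this

/-- First-order condition for a minimizer of a quadratic objective on an affine subspace. -/
theorem Matrix.IsSymm.dotProduct_add_eq_zero_of_forall_le {m n : Type*} [Fintype n]
    {Q : Matrix n n ℝ} (hQ : Q.IsSymm) {A : Matrix m n ℝ} {g d v : n → ℝ} {b : m → ℝ}
    (hd : A *ᵥ d = b)
    (hmin : ∀ x, A *ᵥ x = b →
      (1 / 2) * (d ⬝ᵥ Q *ᵥ d) + g ⬝ᵥ d ≤ (1 / 2) * (x ⬝ᵥ Q *ᵥ x) + g ⬝ᵥ x)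
    (hv : A *ᵥ v = 0) : v ⬝ᵥ Q *ᵥ d + g ⬝ᵥ v = 0 := by
  have hsymm : d ⬝ᵥ Q *ᵥ v = v ⬝ᵥ Q *ᵥ d := by
    rw [dotProduct_mulVec, ← mulVec_transpose, hQ.eq, dotProduct_comm]
  refine eq_zero_of_forall_mul_add_sq_mul_nonneg (b := (1 / 2) * (v ⬝ᵥ Q *ᵥ v)) fun t => ?_
  have h := hmin (d + t • v) (by simp [mulVec_add, mulVec_smul, hd, hv])
  simp only [mulVec_add, mulVec_smul, dotProduct_add, add_dotProduct, dotProduct_smul,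
    smul_dotProduct, smul_eq_mul, hsymm] at h
  linarith

/-- The Schur complement `A H⁻¹ Aᵀ` of a positive definite matrix is positive definite when `A`
has full row rank. -/
theorem Matrix.PosDef.mul_inv_mul_transpose {m n : Type*} [Fintype m] [Fintype n]
    [DecidableEq n] {H : Matrix n n ℝ} (hH : H.PosDef) {A : Matrix m n ℝ}
    (hA : A.rank = Fintype.card m) : (A * H⁻¹ * Aᵀ).PosDef := by
  have hinj : Function.Injective A.vecMul := by
    rw [vecMul_injective_iff, linearIndependent_iff_card_eq_finrank_span, ← hA,
      rank_eq_finrank_span_row]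
    rfl
  simpa [conjTranspose_eq_transpose_of_trivial] using hH.inv.mul_mul_conjTranspose_same hinj

/-- For the Taylor-expanded perturbed program
`min (1/2) dᵀ(H + εH̃)d + (e + εẽ)ᵀ d  s.t.  A d = ε b̃`, where `e = -Aᵀ μ*`
(KKT stationarity of the underlying nonlinear program), the unique minimizer
satisfies `d*_ε = ε B w + o(ε)` with
`B w = H⁻¹(Aᵀ M A H⁻¹ − I) ẽ + H⁻¹ Aᵀ M b̃` and `M = (A H⁻¹ Aᵀ)⁻¹`. -/
theorem stmt12 {p s : ℕ}
    (H Ht : Matrix (Fin p) (Fin p) ℝ) (hH : H.PosDef) (hHt : Ht.IsSymm)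
    (e et : Fin p → ℝ)
    (A : Matrix (Fin s) (Fin p) ℝ) (hA : A.rank = s)
    (bt : Fin s → ℝ)
    (μstar : Fin s → ℝ) (he : e = -(Aᵀ.mulVec μstar))
    (M : Matrix (Fin s) (Fin s) ℝ) (hM : M = (A * H⁻¹ * Aᵀ)⁻¹)
    (Bw : Fin p → ℝ)
    (hBw : Bw = (H⁻¹ * (Aᵀ * M * A * H⁻¹ - 1)).mulVec et + (H⁻¹ * Aᵀ * M).mulVec bt)
    (dpert : ℝ → (Fin p → ℝ))
    (hdpert : ∀ᶠ ε : ℝ in 𝓝 0,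
      A.mulVec (dpert ε) = ε • bt ∧
      ∀ d : Fin p → ℝ, A.mulVec d = ε • bt → d ≠ dpert ε →
        (1/2) * (dpert ε ⬝ᵥ (H + ε • Ht).mulVec (dpert ε)) + (e + ε • et) ⬝ᵥ dpert ε
          < (1/2) * (d ⬝ᵥ (H + ε • Ht).mulVec d) + (e + ε • et) ⬝ᵥ d) :
    (fun ε : ℝ => dpert ε - ε • Bw) =o[𝓝 0] (fun ε : ℝ => ε) := by
  have hdet : IsUnit H.det := (Matrix.isUnit_iff_isUnit_det _).mp hH.isUnit
  have hSM : A * H⁻¹ * Aᵀ * M = 1 := by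
    rw [hM]
    exact mul_nonsing_inv _ ((Matrix.isUnit_iff_isUnit_det _).mp
      (hH.mul_inv_mul_transpose (by simpa using hA)).isUnit)
  have hABw : A *ᵥ Bw = bt := by
    have h1 : A * (H⁻¹ * (Aᵀ * M * A * H⁻¹ - 1)) = 0 := by
      calc _ = (A * H⁻¹ * Aᵀ * M) * (A * H⁻¹) - A * H⁻¹ := by
            simp only [Matrix.mul_sub, Matrix.mul_assoc, Matrix.mul_one]
        _ = 0 := by rw [hSM, Matrix.one_mul, sub_self]
    have h2 : A * (H⁻¹ * Aᵀ * M) = 1 := by simpa only [Matrix.mul_assoc] using hSM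
    rw [hBw, mulVec_add, mulVec_mulVec, mulVec_mulVec, h1, h2, zero_mulVec, one_mulVec, zero_add]
  have hkerT : ∀ (v : Fin p → ℝ) (w : Fin s → ℝ), A *ᵥ v = 0 → v ⬝ᵥ Aᵀ *ᵥ w = 0 := by
    intro v w hv
    rw [dotProduct_mulVec, vecMul_transpose, hv, zero_dotProduct]
  have hHBw : H *ᵥ Bw = Aᵀ *ᵥ (M *ᵥ A *ᵥ H⁻¹ *ᵥ et + M *ᵥ bt) - et := by
    rw [hBw, mulVec_add, mulVec_mulVec, mulVec_mulVec, mul_nonsing_inv_cancel_left _ _ hdet,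
      Matrix.mul_assoc H⁻¹, mul_nonsing_inv_cancel_left _ _ hdet, sub_mulVec, one_mulVec,
      mulVec_add]
    simp only [mulVec_mulVec, Matrix.mul_assoc]
    abel
  obtain ⟨c, hc, hcoer⟩ := hH.exists_mul_sq_norm_le
  obtain ⟨C, hC, hbdd⟩ := Ht.exists_abs_dotProduct_mulVec_le
  have hsmall : ∀ᶠ ε : ℝ in 𝓝 0, |ε| * C < c / 2 := by
    have : Tendsto (fun ε : ℝ => |ε| * C) (𝓝 0) (𝓝 0) := by
      have : Continuous fun ε : ℝ => |ε| * C := by fun_prop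
      simpa using this.tendsto 0
    exact this.eventually_lt_const (by positivity)
  have hO : (fun ε : ℝ => dpert ε - ε • Bw) =O[𝓝 0] (fun ε : ℝ => ε ^ 2) := by
    refine IsBigO.of_bound (2 * C * ‖Bw‖ / c) ?_
    filter_upwards [hdpert, hsmall] with ε ⟨hfeas, hlt⟩ hε
    set u := dpert ε - ε • Bw with hu
    have hd : dpert ε = u + ε • Bw := by simp [hu]
    have hAu : A *ᵥ u = 0 := by rw [hu, mulVec_sub, mulVec_smul, hfeas, hABw, sub_self]
    have hQ : (H + ε • Ht).IsSymm := by
      have hHs : H.IsSymm := by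
        simpa [IsHermitian, IsSymm, conjTranspose_eq_transpose_of_trivial] using hH.isHermitian
      exact hHs.add (hHt.smul ε)
    have hfoc := hQ.dotProduct_add_eq_zero_of_forall_le hfeas (g := e + ε • et)
      (fun x hx => by
        by_cases h : x = dpert ε
        · rw [h]
        · exact (hlt x hx h).le) hAu
    have heu : e ⬝ᵥ u = 0 := by
      rw [he, neg_dotProduct, dotProduct_comm, hkerT u _ hAu, neg_zero]
    have hkey : u ⬝ᵥ H *ᵥ u = -ε * (u ⬝ᵥ Ht *ᵥ u) - ε ^ 2 * (u ⬝ᵥ Ht *ᵥ Bw) := by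
      rw [hd] at hfoc
      simp only [add_mulVec, smul_mulVec, mulVec_add, mulVec_smul, dotProduct_add, add_dotProduct,
        dotProduct_smul, smul_dotProduct, smul_eq_mul, hHBw, dotProduct_sub, heu,
        dotProduct_comm et u] at hfoc
      rw [hkerT u _ hAu, hkerT u _ hAu] at hfoc
      linarith
    have h1 : c * ‖u‖ ^ 2 ≤ |ε| * C * ‖u‖ ^ 2 + ε ^ 2 * (C * ‖u‖ * ‖Bw‖) := by
      have ha : -ε * (u ⬝ᵥ Ht *ᵥ u) ≤ |ε| * (C * ‖u‖ * ‖u‖) := by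
        refine (le_abs_self _).trans ?_
        rw [abs_mul, abs_neg]
        gcongr
        exact hbdd u u
      have hb : -(u ⬝ᵥ Ht *ᵥ Bw) ≤ C * ‖u‖ * ‖Bw‖ := (neg_le_abs _).trans (hbdd u Bw)
      nlinarith [hcoer u, mul_le_mul_of_nonneg_left hb (sq_nonneg ε)]
    have h2 : c / 2 * ‖u‖ ^ 2 ≤ ε ^ 2 * (C * ‖u‖ * ‖Bw‖) := by
      nlinarith [mul_le_mul_of_nonneg_right hε.le (sq_nonneg ‖u‖)]
    rw [Real.norm_of_nonneg (sq_nonneg ε), div_mul_eq_mul_div, le_div_iff₀ hc]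
    rcases (norm_nonneg u).eq_or_lt with h0 | h0
    · rw [← h0, zero_mul]
      positivity
    · refine le_of_mul_le_mul_right ?_ h0
      linarith
  exact hO.trans_isLittleO (isLittleO_pow_id one_lt_two)
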